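/- arXiv:2012.02634 — 2 statements merged into one kernel-verified Lean document; each statement's English description precedes it below -/
import Mathlib

section
/- Let N : (0,∞) → [0,∞) be a nonincreasing function such that λ(ε) := ∫_ε^∞ N(a) da is finite for every ε > 0. Then for all ε > 0: N(2ε) ≤ (λ(ε) − λ(2ε))/ε ≤ N(ε); consequently liminf_{ε→0⁺} log N(ε)/log(1/ε) = liminf_{ε→0⁺} log((λ(ε) − λ(2ε))/ε)/log(1/ε). Moreover, if in addition liminf_{ε→0⁺} log N(ε)/log(1/ε) > 1 and limsup_{ε→0⁺} λ(2ε)/λ(ε) < 1, then liminf_{ε→0⁺} log N(ε)/log(1/ε) = liminf_{ε→0⁺} log(λ(ε)/ε)/log(1/ε). -/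
open Filter Set

/-- Bounded additive perturbations of the numerator and of a divergent denominator
do not decrease the lower limit of a quotient. -/
lemma liminf_div_sub_le_liminf_div {α : Type*} {l : Filter α} {f g L : α → ℝ} {c C : ℝ}
    (hL : Tendsto L l atTop) (hfg : ∀ᶠ x in l, f x ≤ g x + C) :
    liminf (fun x => ((f x / (L x - c) : ℝ) : EReal)) l ≤
      liminf (fun x => ((g x / L x : ℝ) : EReal)) l := by
  refine le_of_forall_lt fun y hy => ?_
  obtain ⟨a, hya, ha⟩ := EReal.lt_iff_exists_real_btwn.1 hy
  obtain ⟨b, hab, hb⟩ := EReal.lt_iff_exists_real_btwn.1 ha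
  have hab' : 0 < b - a := sub_pos.2 (EReal.coe_lt_coe_iff.1 hab)
  refine hya.trans_le (le_liminf_of_le (by isBoundedDefault) ?_)
  filter_upwards [eventually_lt_of_lt_liminf hb, hfg, hL.eventually_gt_atTop 0,
    hL.eventually_gt_atTop c, hL.eventually_ge_atTop ((b * c + C) / (b - a))]
    with x hbx hx h0 hc hx'
  rw [EReal.coe_lt_coe_iff, lt_div_iff₀ (sub_pos.2 hc)] at hbx
  rw [div_le_iff₀ hab'] at hx'
  rw [EReal.coe_le_coe_iff, le_div_iff₀ h0]
  linarith

lemma tendsto_log_one_div_nhdsGT_zero :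
    Tendsto (fun ε : ℝ => Real.log (1 / ε)) (nhdsWithin 0 (Ioi 0)) atTop := by
  simpa only [one_div, Function.comp_def] using Real.tendsto_log_atTop.comp tendsto_inv_nhdsGT_zero

lemma tendsto_two_mul_nhdsGT_zero :
    Tendsto (fun ε : ℝ => 2 * ε) (nhdsWithin 0 (Ioi 0)) (nhdsWithin 0 (Ioi 0)) := by
  refine tendsto_nhdsWithin_iff.2 ⟨?_, ?_⟩
  · have h : Tendsto (fun ε : ℝ => 2 * ε) (nhds 0) (nhds (2 * 0)) :=
      (continuous_const_mul 2).tendsto 0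
    rw [mul_zero] at h
    exact h.mono_left nhdsWithin_le_nhds
  · filter_upwards [self_mem_nhdsWithin] with ε hε
    exact mul_pos two_pos (mem_Ioi.1 hε)

/-- The integral of an antitone function over `(ε, 2ε]`, compared with its endpoint values. -/
lemma AntitoneOn.le_setIntegral_Ioi_sub_div_le {N : ℝ → ℝ} (hmono : AntitoneOn N (Ioi 0))
    (hint : ∀ ε > (0 : ℝ), MeasureTheory.IntegrableOn N (Ioi ε)) {ε : ℝ} (hε : 0 < ε) :
    N (2 * ε) ≤ ((∫ a in Ioi ε, N a) - ∫ a in Ioi (2 * ε), N a) / ε ∧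
      ((∫ a in Ioi ε, N a) - ∫ a in Ioi (2 * ε), N a) / ε ≤ N ε := by
  have hle : ε ≤ 2 * ε := by linarith
  have hii : IntervalIntegrable N MeasureTheory.volume ε (2 * ε) :=
    (intervalIntegrable_iff_integrableOn_Ioc_of_le hle).2 ((hint ε hε).mono_set Ioc_subset_Ioi_self)
  rw [intervalIntegral.integral_Ioi_sub_Ioi (hint ε hε) hle, le_div_iff₀ hε, div_le_iff₀ hε]
  have hconst (c : ℝ) : ∫ _ in ε..2 * ε, c = c * ε := by
    rw [intervalIntegral.integral_const, smul_eq_mul]; ring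
  constructor
  · rw [← hconst (N _)]
    refine intervalIntegral.integral_mono_on hle intervalIntegrable_const hii fun x hx => ?_
    exact hmono (hε.trans_le hx.1) (mul_pos two_pos hε) hx.2
  · rw [← hconst (N _)]
    refine intervalIntegral.integral_mono_on hle hii intervalIntegrable_const fun x hx => ?_
    exact hmono hε (hε.trans_le hx.1) hx.1

/-- let `N : (0,∞) → [0,∞)` be nonincreasing with
`λ(ε) := ∫_ε^∞ N(a) da` finite for every `ε > 0`. Then
`N(2ε) ≤ (λ(ε) - λ(2ε))/ε ≤ N(ε)` for all `ε > 0`, hence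
`liminf_{ε→0⁺} log N(ε)/log(1/ε) = liminf_{ε→0⁺} log((λ(ε)-λ(2ε))/ε)/log(1/ε)`;
moreover if this liminf is `> 1` and `limsup_{ε→0⁺} λ(2ε)/λ(ε) < 1`, then
`liminf_{ε→0⁺} log N(ε)/log(1/ε) = liminf_{ε→0⁺} log(λ(ε)/ε)/log(1/ε)`. -/
theorem leaves_vs_length (N : ℝ → ℝ)
    (hnonneg : ∀ ε > (0 : ℝ), 0 ≤ N ε)
    (hmono : AntitoneOn N (Set.Ioi 0))
    (hint : ∀ ε > (0 : ℝ), MeasureTheory.IntegrableOn N (Set.Ioi ε))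
    (lam : ℝ → ℝ) (hlam : ∀ ε > (0 : ℝ), lam ε = ∫ a in Set.Ioi ε, N a) :
    (∀ ε > (0 : ℝ), N (2 * ε) ≤ (lam ε - lam (2 * ε)) / ε ∧
      (lam ε - lam (2 * ε)) / ε ≤ N ε) ∧
    Filter.liminf
        (fun ε : ℝ => ((Real.log (N ε) / Real.log (1 / ε) : ℝ) : EReal))
        (nhdsWithin 0 (Set.Ioi 0)) =
      Filter.liminf
        (fun ε : ℝ => ((Real.log ((lam ε - lam (2 * ε)) / ε) / Real.log (1 / ε) : ℝ) : EReal))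
        (nhdsWithin 0 (Set.Ioi 0)) ∧
    ((1 : EReal) < Filter.liminf
        (fun ε : ℝ => ((Real.log (N ε) / Real.log (1 / ε) : ℝ) : EReal))
        (nhdsWithin 0 (Set.Ioi 0)) →
      Filter.limsup (fun ε : ℝ => ((lam (2 * ε) / lam ε : ℝ) : EReal))
        (nhdsWithin 0 (Set.Ioi 0)) < 1 →
      Filter.liminf
          (fun ε : ℝ => ((Real.log (N ε) / Real.log (1 / ε) : ℝ) : EReal))
          (nhdsWithin 0 (Set.Ioi 0)) =
        Filter.liminf
          (fun ε : ℝ => ((Real.log (lam ε / ε) / Real.log (1 / ε) : ℝ) : EReal))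
          (nhdsWithin 0 (Set.Ioi 0))) := by
  have hbd : ∀ ε > (0 : ℝ), N (2 * ε) ≤ (lam ε - lam (2 * ε)) / ε ∧
      (lam ε - lam (2 * ε)) / ε ≤ N ε := fun ε hε => by
    rw [hlam ε hε, hlam (2 * ε) (mul_pos two_pos hε)]
    exact hmono.le_setIntegral_Ioi_sub_div_le hint hε
  have hlam_nonneg : ∀ ε > (0 : ℝ), 0 ≤ lam ε := fun ε hε => by
    rw [hlam ε hε]
    exact MeasureTheory.setIntegral_nonneg measurableSet_Ioi
      fun x hx => hnonneg x (hε.trans hx)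
  refine ⟨hbd, ?_⟩
  by_cases hN : ∀ ε > (0 : ℝ), N ε = 0
  · have hlam0 : ∀ ε > (0 : ℝ), lam ε = 0 := fun ε hε => by
      rw [hlam ε hε]
      exact MeasureTheory.setIntegral_eq_zero_of_forall_eq_zero fun x hx => hN x (hε.trans hx)
    refine ⟨liminf_congr ?_, fun _ _ => liminf_congr ?_⟩
    · filter_upwards [self_mem_nhdsWithin] with ε hε
      simp [hN ε hε, hlam0 ε hε, hlam0 (2 * ε) (mul_pos two_pos hε)]
    · filter_upwards [self_mem_nhdsWithin] with ε hε
      simp [hN ε hε, hlam0 ε hε]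
  push Not at hN
  obtain ⟨ε₀, hε₀, hN₀⟩ := hN
  have hpos : ∀ᶠ ε in nhdsWithin (0 : ℝ) (Ioi 0), 0 < N (2 * ε) := by
    filter_upwards [tendsto_two_mul_nhdsGT_zero.eventually (Ioc_mem_nhdsGT hε₀)] with ε hε
    exact ((hnonneg ε₀ hε₀).lt_of_ne' hN₀).trans_le (hmono hε.1 hε₀ hε.2)
  have hL := tendsto_log_one_div_nhdsGT_zero
  have hlower : liminf (fun ε : ℝ => ((Real.log (N ε) / Real.log (1 / ε) : ℝ) : EReal))
        (nhdsWithin 0 (Ioi 0)) ≤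
      liminf (fun ε : ℝ =>
          ((Real.log ((lam ε - lam (2 * ε)) / ε) / Real.log (1 / ε) : ℝ) : EReal))
        (nhdsWithin 0 (Ioi 0)) := by
    calc
      _ ≤ liminf (fun ε : ℝ => ((Real.log (N (2 * ε)) / Real.log (1 / (2 * ε)) : ℝ) : EReal))
          (nhdsWithin 0 (Ioi 0)) :=
        tendsto_two_mul_nhdsGT_zero.liminf_le_liminf_comp
          (u := fun ε : ℝ => ((Real.log (N ε) / Real.log (1 / ε) : ℝ) : EReal))
      _ = liminf (fun ε : ℝ =>
            ((Real.log (N (2 * ε)) / (Real.log (1 / ε) - Real.log 2) : ℝ) : EReal))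
          (nhdsWithin 0 (Ioi 0)) := by
        refine liminf_congr ?_
        filter_upwards [self_mem_nhdsWithin] with ε hε
        rw [← Real.log_div (one_div_ne_zero (ne_of_gt hε)) two_ne_zero, div_div, mul_comm ε]
      _ ≤ _ := by
        refine liminf_div_sub_le_liminf_div (C := 0) hL ?_
        filter_upwards [self_mem_nhdsWithin, hpos] with ε hε hp
        rw [add_zero]
        exact Real.log_le_log hp (hbd ε hε).1
  refine ⟨le_antisymm hlower ?_, fun _ hlim => le_antisymm (hlower.trans ?_) ?_⟩
  · have h := liminf_div_sub_le_liminf_div (c := 0) (C := 0)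
      (f := fun ε => Real.log ((lam ε - lam (2 * ε)) / ε)) (g := fun ε => Real.log (N ε)) hL (by
        filter_upwards [self_mem_nhdsWithin, hpos] with ε hε hp
        rw [add_zero]
        exact Real.log_le_log (hp.trans_le (hbd ε hε).1) (hbd ε hε).2)
    simpa only [sub_zero] using h
  · have h := liminf_div_sub_le_liminf_div (c := 0) (C := 0)
      (f := fun ε => Real.log ((lam ε - lam (2 * ε)) / ε))
      (g := fun ε => Real.log (lam ε / ε)) hL (by
        filter_upwards [self_mem_nhdsWithin, hpos] with ε hε hp
        have hε' : 0 < ε := hε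
        rw [add_zero]
        refine Real.log_le_log (hp.trans_le (hbd ε hε).1) ?_
        gcongr
        linarith [hlam_nonneg (2 * ε) (mul_pos two_pos hε)])
    simpa only [sub_zero] using h
  · obtain ⟨r, hr, hr1⟩ := EReal.lt_iff_exists_real_btwn.1 hlim
    have hr1' : 0 < 1 - r := sub_pos.2 (by exact_mod_cast hr1)
    have h := liminf_div_sub_le_liminf_div (c := 0) (C := -Real.log (1 - r))
      (f := fun ε => Real.log (lam ε / ε)) (g := fun ε => Real.log (N ε)) hL (by
        filter_upwards [self_mem_nhdsWithin, hpos, eventually_lt_of_limsup_lt hr]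
          with ε hε hp hrε
        have hε' : 0 < ε := hε
        have hdiff : 0 < lam ε - lam (2 * ε) :=
          (div_pos_iff_of_pos_right hε').1 (hp.trans_le (hbd ε hε).1)
        have hlpos : 0 < lam ε := by
          linarith [hlam_nonneg (2 * ε) (mul_pos two_pos hε)]
        rw [EReal.coe_lt_coe_iff, div_lt_iff₀ hlpos] at hrε
        have hNε : (1 - r) * (lam ε / ε) ≤ N ε := by
          refine le_trans ?_ (hbd ε hε).2
          rw [← mul_div_assoc]
          gcongr
          linarith
        have hq : 0 < lam ε / ε := div_pos hlpos hε'
        have hlog := Real.log_le_log (mul_pos hr1' hq) hNε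
        rw [Real.log_mul hr1'.ne' hq.ne'] at hlog
        linarith)
    simpa only [sub_zero] using h
end

section
/- Let (T, d) be a nonempty compact, connected metric space which is geodesic (for all x, y ∈ T there is a map γ : [0, d(x,y)] → T with γ(0) = x, γ(d(x,y)) = y and d(γ(s), γ(t)) = |s − t| for all s, t) and contains no subspace homeomorphic to the circle S¹ (i.e. T is a compact ℝ-tree), and suppose its upper box dimension D := updim T is finite. Then for every δ > 0 there exists a continuous function f : [0,1] → ℝ which is (1/(D+δ))-Hölder continuous and such that the tree T_f associated to f is isometric to T. -/
/-- `[x↦y]` : the supremum over continuous paths `γ` from `x` to `y` of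
`inf_{t ∈ [0,1]} f (γ t)`. -/
noncomputable def pathInfSup {X : Type*} [TopologicalSpace X] (f : X → ℝ) (x y : X) : ℝ :=
  sSup {r : ℝ | ∃ γ : Path x y, r = ⨅ t : unitInterval, f (γ t)}

/-- The pseudo-distance `d_f(x,y) = f x + f y - 2 [x↦y]`. -/
noncomputable def dPseudo {X : Type*} [TopologicalSpace X] (f : X → ℝ) (x y : X) : ℝ :=
  f x + f y - 2 * pathInfSup f x y

/-- `𝒩_Z(ε)`: the minimal number of closed balls of radius `ε` needed to cover `Z`. -/
noncomputable def coverNumber (Z : Type*) [PseudoMetricSpace Z] (ε : ℝ) : ℕ :=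
  sInf {n : ℕ | ∃ s : Finset Z, s.card = n ∧
    (Set.univ : Set Z) ⊆ ⋃ x ∈ s, Metric.closedBall x ε}

/-- Upper box dimension: `limsup_{ε→0⁺} log 𝒩_Z(ε) / log (1/ε)`. -/
noncomputable def updim (Z : Type*) [PseudoMetricSpace Z] : EReal :=
  Filter.limsup
    (fun ε : ℝ => ((Real.log (coverNumber Z ε) / Real.log (1 / ε) : ℝ) : EReal))
    (nhdsWithin 0 (Set.Ioi 0))

/-- A space without embedded circles carries no simple closed curve. -/
theorem not_injOn_loop {T : Type*} [MetricSpace T]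
    (hnocircle : ¬ ∃ φ : Circle → T, Topology.IsEmbedding φ)
    {f : ℝ → T} {L : ℝ} (hL : 0 < L) (hf : Continuous f) (h0 : f 0 = f L) :
    ¬ Set.InjOn f (Set.Ico 0 L) := by
  intro hinj
  have : Fact (0 < L) := ⟨hL⟩
  have hcont : Continuous (AddCircle.liftIco L 0 f) :=
    AddCircle.liftIco_continuous (by simpa using h0) hf.continuousOn
  have hinj' : Function.Injective (AddCircle.liftIco L 0 f) := by
    intro u v huv
    obtain ⟨x, hx, rfl⟩ := AddCircle.eq_coe_Ico u
    obtain ⟨y, hy, rfl⟩ := AddCircle.eq_coe_Ico v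
    rw [AddCircle.liftIco_coe_apply (by simpa using hx),
      AddCircle.liftIco_coe_apply (by simpa using hy)] at huv
    rw [hinj hx hy huv]
  exact hnocircle ⟨_, (hcont.isClosedEmbedding hinj').isEmbedding.comp
    (AddCircle.homeomorphCircle hL.ne').symm.isEmbedding⟩

/-- A space without embedded circles contains no triangle made of three arcs with disjoint
interiors. -/
theorem not_arc_triangle {T : Type*} [MetricSpace T]
    (hnocircle : ¬ ∃ φ : Circle → T, Topology.IsEmbedding φ) {α β η : ℝ → T}
    (hα : Continuous α) (hβ : Continuous β) (hη : Continuous η)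
    (iα : Set.InjOn α (Set.Icc 0 1)) (iβ : Set.InjOn β (Set.Icc 0 1))
    (iη : Set.InjOn η (Set.Icc 0 1))
    (h0 : α 0 = β 0) (h1 : α 1 = η 0) (h2 : η 1 = β 1)
    (hαη : ∀ s ∈ Set.Ico (0 : ℝ) 1, ∀ t ∈ Set.Icc (0 : ℝ) 1, α s ≠ η t)
    (hβη : ∀ s ∈ Set.Ico (0 : ℝ) 1, ∀ t ∈ Set.Icc (0 : ℝ) 1, β s ≠ η t)
    (hαβ : ∀ s ∈ Set.Ioc (0 : ℝ) 1, ∀ t ∈ Set.Ioc (0 : ℝ) 1, α s ≠ β t) : False := by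
  set f : ℝ → T := fun t => if t ≤ 1 then α t else if t ≤ 2 then η (t - 1) else β (3 - t)
    with hf
  have hcont : Continuous f := by
    refine Continuous.if_le hα (Continuous.if_le (by fun_prop) (by fun_prop) (by fun_prop)
      (by fun_prop) ?_) (by fun_prop) (by fun_prop) ?_
    · rintro x rfl
      norm_num [h2]
    · rintro x rfl
      norm_num [h1]
  have key : ∀ s t, 0 ≤ s → s < t → t < 3 → f s ≠ f t := by
    intro s t hs hst ht heq
    simp only [hf] at heq
    split_ifs at heq with a b c d e g h
    · exact hst.ne (iα ⟨hs, a⟩ ⟨by linarith, b⟩ heq)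
    · rcases a.lt_or_eq with a' | rfl
      · exact hαη s ⟨hs, a'⟩ (t - 1) ⟨by linarith, by linarith⟩ heq
      · rw [h1] at heq
        have := iη ⟨le_rfl, zero_le_one⟩ ⟨by linarith, by linarith⟩ heq
        linarith
    · rcases hs.lt_or_eq with hs' | rfl
      · exact hαβ s ⟨hs', a⟩ (3 - t) ⟨by linarith, by linarith⟩ heq
      · rw [h0] at heq
        have := iβ ⟨le_rfl, zero_le_one⟩ ⟨by linarith, by linarith⟩ heq
        linarith
    · linarith
    · have := iη ⟨by linarith, by linarith⟩ ⟨by linarith, by linarith⟩ heq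
      linarith
    · exact hβη (3 - t) ⟨by linarith, by linarith⟩ (s - 1) ⟨by linarith, by linarith⟩ heq.symm
    · linarith
    · linarith
    · have := iβ ⟨by linarith, by linarith⟩ ⟨by linarith, by linarith⟩ heq
      linarith
  refine not_injOn_loop hnocircle (L := 3) (by norm_num) hcont ?_ ?_
  · norm_num [hf, h0]
  · intro s hs t ht heq
    rcases lt_trichotomy s t with h | h | h
    · exact absurd heq (key s t hs.1 h ht.2)
    · exact h
    · exact absurd heq.symm (key t s ht.1 h hs.2)

/-- `γ` is a continuous map whose restriction to `[0, dist x y]` is a geodesic from `x` to `y`. -/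
structure IsGeodesic {T : Type*} [MetricSpace T] (γ : ℝ → T) (x y : T) : Prop where
  continuous : Continuous γ
  map_zero : γ 0 = x
  map_dist : γ (dist x y) = y
  dist_map : ∀ s ∈ Set.Icc (0 : ℝ) (dist x y), ∀ t ∈ Set.Icc (0 : ℝ) (dist x y),
    dist (γ s) (γ t) = |s - t|

namespace IsGeodesic

variable {T : Type*} [MetricSpace T] {γ : ℝ → T} {x y : T}

theorem dist_left (h : IsGeodesic γ x y) {s : ℝ} (hs : s ∈ Set.Icc (0 : ℝ) (dist x y)) :
    dist x (γ s) = s := by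
  have := h.dist_map 0 ⟨le_rfl, dist_nonneg⟩ s hs
  rw [h.map_zero] at this
  simpa [abs_of_nonneg hs.1] using this

theorem dist_right (h : IsGeodesic γ x y) {s : ℝ} (hs : s ∈ Set.Icc (0 : ℝ) (dist x y)) :
    dist (γ s) y = dist x y - s := by
  have := h.dist_map s hs _ ⟨dist_nonneg, le_rfl⟩
  rw [h.map_dist] at this
  rw [this, abs_sub_comm, abs_of_nonneg (sub_nonneg.2 hs.2)]

theorem injOn (h : IsGeodesic γ x y) : Set.InjOn γ (Set.Icc 0 (dist x y)) := by
  intro s hs t ht hst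
  rw [← h.dist_left hs, ← h.dist_left ht, hst]

end IsGeodesic

theorem exists_isGeodesic {T : Type*} [MetricSpace T]
    (hgeo : ∀ x y : T, ∃ γ : ℝ → T, γ 0 = x ∧ γ (dist x y) = y ∧
      ∀ s ∈ Set.Icc (0 : ℝ) (dist x y), ∀ t ∈ Set.Icc (0 : ℝ) (dist x y),
        dist (γ s) (γ t) = |s - t|) (x y : T) : ∃ γ, IsGeodesic γ x y := by
  obtain ⟨γ, h0, h1, h⟩ := hgeo x y
  have hclamp : ∀ s ∈ Set.Icc (0 : ℝ) (dist x y), max 0 (min s (dist x y)) = s := by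
    intro s hs
    rw [min_eq_left hs.2, max_eq_right hs.1]
  have hmem : ∀ s, max 0 (min s (dist x y)) ∈ Set.Icc (0 : ℝ) (dist x y) := fun s =>
    ⟨le_max_left _ _, max_le dist_nonneg (min_le_right _ _)⟩
  refine ⟨fun s => γ (max 0 (min s (dist x y))), ?_, ?_, ?_, ?_⟩
  · have : ContinuousOn γ (Set.Icc 0 (dist x y)) := by
      refine LipschitzOnWith.continuousOn (K := 1) (LipschitzOnWith.of_dist_le_mul ?_)
      intro s hs t ht
      rw [h s hs t ht, Real.dist_eq]
      simp
    exact this.comp_continuous (by fun_prop) hmem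
  · simp [h0]
  · simp [h1]
  · intro s hs t ht
    simp only [hclamp s hs, hclamp t ht, h s hs t ht]

/-- The Gromov product of `x` and `y` with respect to the base point `r`. -/
noncomputable def gromovProd {T : Type*} [MetricSpace T] (r x y : T) : ℝ :=
  (dist r x + dist r y - dist x y) / 2

section gromovProd

variable {T : Type*} [MetricSpace T] (r x y : T)

theorem gromovProd_comm : gromovProd r x y = gromovProd r y x := by
  simp only [gromovProd, dist_comm x y]; ring

theorem gromovProd_le_left : gromovProd r x y ≤ dist r x := by
  have := dist_triangle r x y
  simp only [gromovProd]; linarith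

theorem gromovProd_le_right : gromovProd r x y ≤ dist r y := by
  rw [gromovProd_comm]; exact gromovProd_le_left r y x

theorem gromovProd_nonneg : 0 ≤ gromovProd r x y := by
  have := dist_triangle_left x y r
  simp only [gromovProd]; linarith

theorem gromovProd_self : gromovProd r x x = dist r x := by
  simp [gromovProd]

end gromovProd

/-- In a geodesic space without circles, the point at height `h ≤ gromovProd r x y` of a geodesic
from `r` to `y` lies between `r` and `x`. -/
theorem IsGeodesic.dist_eq_of_le_gromovProd {T : Type*} [MetricSpace T]
    (hgeo : ∀ x y : T, ∃ γ, IsGeodesic γ x y)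
    (hnocircle : ¬ ∃ φ : Circle → T, Topology.IsEmbedding φ) {r y : T} {α : ℝ → T}
    (hα : IsGeodesic α r y) (x : T) {h : ℝ} (h0 : 0 ≤ h) (hh : h ≤ gromovProd r x y) :
    dist (α h) x = dist r x - h := by
  obtain ⟨β, hβ⟩ := hgeo r x
  obtain ⟨η, hη⟩ := hgeo y x
  have hhy := hh.trans (gromovProd_le_right r x y)
  have hhx := hh.trans (gromovProd_le_left r x y)
  have lower : dist r x - h ≤ dist (α h) x := by
    have := dist_triangle r (α h) x
    rw [hα.dist_left ⟨h0, hhy⟩] at this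
    linarith
  have hScomp : IsCompact {s | s ∈ Set.Icc 0 (min (dist r y) (dist r x)) ∧ α s = β s} :=
    isCompact_Icc.inter_right (isClosed_eq hα.continuous hβ.continuous)
  obtain ⟨a, ⟨⟨ha0, ha1⟩, hab⟩, hamax⟩ := hScomp.exists_isGreatest
    ⟨0, ⟨le_rfl, le_min dist_nonneg dist_nonneg⟩, by rw [hα.map_zero, hβ.map_zero]⟩
  have hay := ha1.trans (min_le_left _ _)
  have hax := ha1.trans (min_le_right _ _)
  rcases le_or_gt h a with hha | hha
  · refine le_antisymm ?_ lower
    have h1 := dist_triangle (α h) (α a) x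
    rw [hα.dist_map h ⟨h0, hhy⟩ a ⟨ha0, hay⟩, abs_sub_comm, abs_of_nonneg (sub_nonneg.2 hha),
      hab, hβ.dist_right ⟨ha0, hax⟩] at h1
    linarith
  exfalso
  have hdisj : ∀ s, a < s → s ≤ dist r y → ∀ t, a < t → t ≤ dist r x → α s ≠ β t := by
    intro s hs hs' t ht ht' heq
    have hst : s = t := by
      rw [← hα.dist_left ⟨ha0.trans hs.le, hs'⟩, heq, hβ.dist_left ⟨ha0.trans ht.le, ht'⟩]
    subst hst
    exact absurd (hamax ⟨⟨ha0.trans hs.le, le_min hs' ht'⟩, heq⟩) (not_le.2 hs)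
  have hlen : dist y x < dist r y - a + (dist r x - a) := by
    simp only [gromovProd, dist_comm x y] at hh; linarith
  have haη : ∀ t ∈ Set.Icc 0 (dist y x), α a ≠ η t := by
    intro t ht heq
    have h1 := hη.dist_left ht
    have h2 := hη.dist_right ht
    rw [← heq, dist_comm, hα.dist_right ⟨ha0, hay⟩] at h1
    rw [← heq, hab, hβ.dist_right ⟨ha0, hax⟩] at h2
    linarith
  have hηcl : IsClosed (η '' Set.Icc 0 (dist y x)) := (isCompact_Icc.image hη.continuous).isClosed
  obtain ⟨u, ⟨⟨hau, huy⟩, ⟨t, ht, htu⟩⟩, humin⟩ :=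
    ((isCompact_Icc (a := a) (b := dist r y)).inter_right
      (hηcl.preimage hα.continuous)).exists_isLeast
      ⟨dist r y, ⟨hay, le_rfl⟩, 0, ⟨le_rfl, dist_nonneg⟩, by rw [hη.map_zero, hα.map_dist]⟩
  obtain ⟨v, ⟨⟨hav, hvx⟩, ⟨t', ht', htv⟩⟩, hvmin⟩ :=
    ((isCompact_Icc (a := a) (b := dist r x)).inter_right
      (hηcl.preimage hβ.continuous)).exists_isLeast
      ⟨dist r x, ⟨hax, le_rfl⟩, dist y x, ⟨dist_nonneg, le_rfl⟩, by rw [hη.map_dist, hβ.map_dist]⟩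
  have hau' : a < u := hau.lt_of_ne (by rintro rfl; exact haη t ht htu.symm)
  have hav' : a < v := hav.lt_of_ne (by rintro rfl; exact haη t' ht' (hab.trans htv.symm))
  have htt : t ≠ t' := by
    rintro rfl
    exact hdisj u hau' huy v hav' hvx (htu.symm.trans htv)
  have mem : ∀ {b c d e s : ℝ}, b ∈ Set.Icc d e → c ∈ Set.Icc d e → s ∈ Set.Icc (0 : ℝ) 1 →
      b + s * (c - b) ∈ Set.Icc d e := by
    intro b c d e s hb hc hs
    have := (convex_Icc d e).add_smul_sub_mem hb hc hs
    simpa using this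
  have inj : ∀ {g : ℝ → T} {b c d e : ℝ}, Set.InjOn g (Set.Icc d e) → b ∈ Set.Icc d e →
      c ∈ Set.Icc d e → b ≠ c → Set.InjOn (fun s => g (b + s * (c - b))) (Set.Icc 0 1) := by
    intro g b c d e hg hb hc hbc s hs s' hs' heq
    have := hg (mem hb hc hs) (mem hb hc hs') heq
    have h2 : s * (c - b) = s' * (c - b) := by linarith
    exact mul_right_cancel₀ (sub_ne_zero.2 hbc.symm) h2
  have cα := hα.continuous
  have cβ := hβ.continuous
  have cη := hη.continuous
  refine not_arc_triangle hnocircle (α := fun s => α (a + s * (u - a)))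
    (β := fun s => β (a + s * (v - a))) (η := fun s => η (t + s * (t' - t)))
    (by fun_prop) (by fun_prop) (by fun_prop)
    (inj hα.injOn ⟨ha0, hay⟩ ⟨ha0.trans hau, huy⟩ hau'.ne)
    (inj hβ.injOn ⟨ha0, hax⟩ ⟨ha0.trans hav, hvx⟩ hav'.ne)
    (inj hη.injOn ht ht' htt) (by simpa using hab) (by simp [htu]) (by simp [htv]) ?_ ?_ ?_
  · intro s hs s' hs' heq
    have h1 := mem (d := a) (e := dist r y) ⟨le_rfl, hay⟩ ⟨hau, huy⟩ ⟨hs.1, hs.2.le⟩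
    have := humin ⟨h1, _, mem ht ht' hs', heq.symm⟩
    nlinarith [hs.2]
  · intro s hs s' hs' heq
    have h1 := mem (d := a) (e := dist r x) ⟨le_rfl, hax⟩ ⟨hav, hvx⟩ ⟨hs.1, hs.2.le⟩
    have := hvmin ⟨h1, _, mem ht ht' hs', heq.symm⟩
    nlinarith [hs.2]
  · intro s hs s' hs'
    have h1 := mem (d := a) (e := dist r y) ⟨le_rfl, hay⟩ ⟨hau, huy⟩ ⟨hs.1.le, hs.2⟩
    have h2 := mem (d := a) (e := dist r x) ⟨le_rfl, hax⟩ ⟨hav, hvx⟩ ⟨hs'.1.le, hs'.2⟩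
    exact hdisj _ (by nlinarith [hs.1]) h1.2 _ (by nlinarith [hs'.1]) h2.2

/-- Zero-hyperbolicity of geodesic spaces without circles. -/
theorem min_gromovProd_le {T : Type*} [MetricSpace T]
    (hgeo : ∀ x y : T, ∃ γ, IsGeodesic γ x y)
    (hnocircle : ¬ ∃ φ : Circle → T, Topology.IsEmbedding φ) (r x y z : T) :
    min (gromovProd r x y) (gromovProd r y z) ≤ gromovProd r x z := by
  obtain ⟨α, hα⟩ := hgeo r y
  set g := min (gromovProd r x y) (gromovProd r y z) with hg
  have hg0 : 0 ≤ g := le_min (gromovProd_nonneg _ _ _) (gromovProd_nonneg _ _ _)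
  have h1 := hα.dist_eq_of_le_gromovProd hgeo hnocircle x hg0 (min_le_left _ _)
  have h2 := hα.dist_eq_of_le_gromovProd hgeo hnocircle z hg0
    ((min_le_right _ _).trans_eq (gromovProd_comm _ _ _))
  have h3 := dist_triangle_left x z (α g)
  rw [gromovProd]
  linarith

theorem rpow_sub_rpow_le {p a b B : ℝ} (hp : 1 ≤ p) (hb : 0 ≤ b) (hba : b ≤ a) (haB : a ≤ B) :
    a ^ p - b ^ p ≤ p * ((a - b) * B ^ (p - 1)) := by
  have ha : 0 ≤ a := hb.trans hba
  rcases ha.eq_or_lt with rfl | ha'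
  · obtain rfl : b = 0 := le_antisymm hba hb
    simp
  have h1 : a ^ p - b ^ p ≤ p * ((a - b) * a ^ (p - 1)) := by
    have hs : -1 ≤ b / a - 1 := by
      have : 0 ≤ b / a := by positivity
      linarith
    have h2 := one_add_mul_self_le_rpow_one_add hs hp
    rw [add_sub_cancel, Real.div_rpow hb ha, le_div_iff₀ (by positivity)] at h2
    rw [Real.rpow_sub_one ha'.ne']
    have h3 : (1 + p * (b / a - 1)) * a ^ p = a ^ p - p * ((a - b) * (a ^ p / a)) := by
      field_simp
      ring
    linarith
  refine h1.trans ?_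
  have : a ^ (p - 1) ≤ B ^ (p - 1) := Real.rpow_le_rpow ha haB (by linarith)
  have : 0 ≤ a - b := sub_nonneg.2 hba
  gcongr

/-- A tree contour: `π` walks around the finite subtree spanned by `r` and a finite set `S`,
starting and ending at `r`, never descending below the branch point of two visited points in
between, and with the speed controlled from above in terms of the depth of the branches. -/
structure IsTreeContour {T : Type*} [MetricSpace T] (r : T) (p : ℝ) (π : ℝ → T) (a : ℝ) :
    Prop where
  nonneg : 0 ≤ a
  eq_of_nonpos : ∀ t ≤ 0, π t = r
  eq_of_ge : ∀ t, a ≤ t → π t = r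
  range_eq : ∃ S : Set T, S.Finite ∧ S.Nonempty ∧
    Set.range π = {v | ∃ s ∈ S, dist r v + dist v s = dist r s}
  contour : ∀ x t y, x ≤ t → t ≤ y → gromovProd r (π x) (π y) ≤ dist r (π t)
  slow : ∀ x y w, (∀ s, dist (π s) w = dist (π s) (π y) + dist (π y) w) →
    (dist r (π y) - gromovProd r (π x) (π y) + dist (π y) w) ^ p - dist (π y) w ^ p ≤ p * |x - y|

/-- The time change collapsing an excursion of duration `2 * c` started at time `τ`. -/
def collapseTime (τ c t : ℝ) : ℝ := min t (max τ (t - 2 * c))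

/-- The tent of height `c` over `[τ, τ + 2 * c]`. -/
def tent (τ c t : ℝ) : ℝ := max 0 (c - |t - τ - c|)

section tent

variable {τ c x y t : ℝ}

theorem tent_nonneg : 0 ≤ tent τ c t := le_max_left _ _

theorem tent_le (hc : 0 ≤ c) : tent τ c t ≤ c := by
  simp only [tent]; grind

theorem tent_add (h0 : 0 ≤ t) (hc : t ≤ c) : tent τ c (τ + t) = t := by
  simp only [tent]; grind

theorem collapseTime_mono (h : x ≤ y) : collapseTime τ c x ≤ collapseTime τ c y := by
  simp only [collapseTime]; grind

theorem abs_collapseTime_sub_le (hc : 0 ≤ c) :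
    |collapseTime τ c x - collapseTime τ c y| ≤ |x - y| := by
  simp only [collapseTime]; grind

theorem abs_tent_sub_le : |tent τ c x - tent τ c y| ≤ |x - y| := by
  simp only [tent]; grind

theorem collapseTime_eq (h : 0 < tent τ c t) : collapseTime τ c t = τ := by
  simp only [tent, collapseTime] at *; grind

theorem min_tent_le (hx : x ≤ t) (hy : t ≤ y) :
    min (tent τ c x) (tent τ c y) ≤ tent τ c t := by
  simp only [tent]; grind

theorem abs_collapseTime_sub_add_tent_le (hc : 0 ≤ c) (hx : tent τ c x = 0)
    (hy : 0 < tent τ c y) : |collapseTime τ c x - τ| + tent τ c y ≤ |x - y| := by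
  simp only [tent, collapseTime] at *; grind

theorem exists_collapseTime_eq (hc : 0 ≤ c) (σ : ℝ) :
    ∃ t, collapseTime τ c t = σ ∧ tent τ c t = 0 := by
  simp only [tent, collapseTime]
  rcases le_or_gt σ τ with h | h
  · exact ⟨σ, by grind, by grind⟩
  · exact ⟨σ + 2 * c, by grind, by grind⟩

theorem collapseTime_of_nonpos (hτ : 0 ≤ τ) (hc : 0 ≤ c) (ht : t ≤ 0) :
    collapseTime τ c t = t ∧ tent τ c t = 0 := by
  simp only [tent, collapseTime]; grind

theorem collapseTime_of_ge {a : ℝ} (hτ : τ ≤ a) (hc : 0 ≤ c) (ht : a + 2 * c ≤ t) :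
    a ≤ collapseTime τ c t ∧ tent τ c t = 0 := by
  simp only [tent, collapseTime]; grind

end tent

namespace IsTreeContour

variable {T : Type*} [MetricSpace T] {r : T} {p : ℝ} {π : ℝ → T} {a : ℝ}

theorem exists_mem_Icc (h : IsTreeContour r p π a) (t : ℝ) : ∃ s ∈ Set.Icc 0 a, π s = π t := by
  rcases le_or_gt t 0 with h0 | h0
  · exact ⟨0, ⟨le_rfl, h.nonneg⟩, by rw [h.eq_of_nonpos t h0, h.eq_of_nonpos 0 le_rfl]⟩
  rcases le_or_gt t a with h1 | h1
  · exact ⟨t, ⟨h0.le, h1⟩, rfl⟩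
  · exact ⟨a, ⟨h.nonneg, le_rfl⟩, by rw [h.eq_of_ge t h1.le, h.eq_of_ge a le_rfl]⟩

theorem const (r : T) (hp : 0 < p) : IsTreeContour r p (fun _ => r) 0 where
  nonneg := le_rfl
  eq_of_nonpos _ _ := rfl
  eq_of_ge _ _ := rfl
  range_eq := by
    refine ⟨{r}, Set.finite_singleton r, Set.singleton_nonempty r, ?_⟩
    ext v
    simp only [Set.range_const, Set.mem_singleton_iff, exists_eq_left, Set.mem_ofPred_eq,
      dist_self]
    constructor
    · rintro rfl
      simp
    · intro hv
      have := dist_comm r v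
      exact (dist_le_zero.1 (by linarith)).symm ▸ rfl
  contour x t y _ _ := by simp [gromovProd]
  slow x y w _ := by
    simp only [gromovProd, dist_self]
    simp
    positivity

/-- An excursion along a new branch, ending at a prescribed point, can be inserted in a tree
contour. -/
theorem exists_insert (hyp : ∀ x y z : T,
      min (gromovProd r x y) (gromovProd r y z) ≤ gromovProd r x z)
    (hgeo : ∀ x y : T, ∃ γ, IsGeodesic γ x y) (hp : 1 ≤ p) (h : IsTreeContour r p π a)
    {B : ℝ} (hB0 : 0 < B) (hB : ∀ z, ∃ t, dist (π t) z ≤ B) (y₀ : T) :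
    ∃ π' a', IsTreeContour r p π' a' ∧ a' ≤ a + 2 * B ^ p ∧ Set.range π ⊆ Set.range π' ∧
      y₀ ∈ Set.range π' := by
  obtain ⟨S, hSfin, hSne, hS⟩ := h.range_eq
  obtain ⟨γ, hγ⟩ := hgeo r y₀
  obtain ⟨s₀, hs₀, hmax⟩ := Set.exists_max_image S (fun s => gromovProd r s y₀) hSfin hSne
  set m := gromovProd r s₀ y₀ with hm
  have hm0 : 0 ≤ m := gromovProd_nonneg _ _ _
  have hmd : m ≤ dist r y₀ := gromovProd_le_right _ _ _
  have hγd : ∀ {k}, 0 ≤ k → k ≤ dist r y₀ → dist r (γ k) = k := fun h0 h1 => hγ.dist_left ⟨h0, h1⟩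
  have hγg : ∀ {k}, 0 ≤ k → k ≤ dist r y₀ → gromovProd r (γ k) y₀ = k := by
    intro k h0 h1
    rw [gromovProd, hγd h0 h1, hγ.dist_right ⟨h0, h1⟩]; ring
  -- the part of the new branch below height `m` belongs to the old tree
  have hlow : ∀ v, dist r v + dist v y₀ = dist r y₀ → dist r v ≤ m → v ∈ Set.range π := by
    intro v hv hvm
    rw [hS]
    refine ⟨s₀, hs₀, ?_⟩
    have h1 : gromovProd r v y₀ = dist r v := by rw [gromovProd]; linarith
    have h2 := hyp v y₀ s₀
    rw [h1, gromovProd_comm r y₀ s₀, ← hm, min_eq_left hvm, gromovProd] at h2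
    have := dist_triangle r v s₀
    linarith
  have hgle : ∀ s, gromovProd r (π s) y₀ ≤ m := by
    intro s
    have : π s ∈ Set.range π := ⟨s, rfl⟩
    rw [hS] at this
    obtain ⟨s', hs', hd⟩ := this
    refine le_trans ?_ (hmax s' hs')
    have h1 : gromovProd r s' (π s) = dist r (π s) := by
      rw [gromovProd_comm, gromovProd]; linarith
    have h2 := hyp s' (π s) y₀
    rwa [h1, min_eq_right (gromovProd_le_left _ _ _)] at h2
  -- distances from the old tree to the new branch
  have hbr : ∀ s k, m ≤ k → k ≤ dist r y₀ → dist (π s) (γ k) = dist (π s) (γ m) + (k - m) := by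
    have aux : ∀ s k, m ≤ k → k ≤ dist r y₀ → gromovProd r (π s) (γ k) = gromovProd r (π s) y₀ := by
      intro s k hk hk'
      have hk0 := hm0.trans hk
      have h1 := hyp (π s) y₀ (γ k)
      have h2 := hyp (π s) (γ k) y₀
      have h3 := gromovProd_le_right r (π s) (γ k)
      rw [hγd hk0 hk'] at h3
      rw [gromovProd_comm r y₀, hγg hk0 hk', min_eq_left ((hgle s).trans hk)] at h1
      rw [hγg hk0 hk', min_eq_left h3] at h2
      exact le_antisymm h2 h1
    intro s k hk hk'
    have h1 := aux s k hk hk'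
    have h2 := aux s m le_rfl hmd
    rw [← h2] at h1
    rw [gromovProd, gromovProd, hγd (hm0.trans hk) hk', hγd hm0 hmd] at h1
    linarith
  obtain ⟨τ', hτ'⟩ : γ m ∈ Set.range π := by
    refine hlow _ ?_ (hγd hm0 hmd).le
    rw [hγd hm0 hmd, hγ.dist_right ⟨hm0, hmd⟩]; ring
  obtain ⟨τ, hτI, hτ⟩ := h.exists_mem_Icc τ'
  rw [hτ'] at hτ
  have hproj : ∀ w s, (∀ z, dist (π z) w = dist (π z) (π s) + dist (π s) w) →
      dist (π s) w ≤ B := by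
    intro w s hw
    obtain ⟨t, ht⟩ := hB w
    rw [hw t] at ht
    linarith [dist_nonneg (x := π t) (y := π s)]
  set κ := B ^ (p - 1) with hκ
  have hκ0 : 0 < κ := Real.rpow_pos_of_pos hB0 _
  set l := dist r y₀ - m with hl
  have hl0 : 0 ≤ l := by linarith
  have hlB : l ≤ B := by
    have h1 := hproj y₀ τ (fun z => by
      have := hbr z _ hmd le_rfl
      rw [hγ.map_dist] at this
      rw [hτ, hγ.dist_right ⟨hm0, hmd⟩, this])
    rwa [hτ, hγ.dist_right ⟨hm0, hmd⟩] at h1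
  set c := κ * l with hc
  have hc0 : 0 ≤ c := by positivity
  set ρ : ℝ → ℝ := collapseTime τ c with hρ
  set e : ℝ → ℝ := fun t => tent τ c t / κ with he
  have heκ : ∀ t, tent τ c t = κ * e t := fun t => by simp only [he]; field_simp
  have he0 : ∀ t, 0 ≤ e t := fun t => div_nonneg tent_nonneg hκ0.le
  have hel : ∀ t, e t ≤ l := fun t => by
    have := tent_le (τ := τ) (t := t) hc0
    rw [heκ, hc] at this
    exact le_of_mul_le_mul_left this hκ0
  have heρ : ∀ t, 0 < e t → ρ t = τ := fun t ht =>
    collapseTime_eq (by rw [heκ]; positivity)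
  set π' : ℝ → T := fun t => if e t = 0 then π (ρ t) else γ (m + e t) with hπ'
  have hπ0 : ∀ t, e t = 0 → π' t = π (ρ t) := fun t ht => by simp only [hπ', if_pos ht]
  have hπ1 : ∀ t, 0 < e t → π' t = γ (m + e t) := fun t ht => by simp only [hπ', if_neg ht.ne']
  have F1 : ∀ s t, dist (π s) (π' t) = dist (π s) (π (ρ t)) + e t := by
    intro s t
    rcases (he0 t).eq_or_lt with h0 | h0
    · rw [hπ0 t h0.symm, ← h0, add_zero]
    · rw [hπ1 t h0, heρ t h0, hτ, hbr s _ (by linarith) (by linarith [hel t])]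
      ring
  have Fr : ∀ t, dist r (π' t) = dist r (π (ρ t)) + e t := by
    intro t
    have := F1 0 t
    rwa [h.eq_of_nonpos 0 le_rfl] at this
  have G1 : ∀ x y, (e x = 0 ∨ e y = 0) →
      gromovProd r (π' x) (π' y) = gromovProd r (π (ρ x)) (π (ρ y)) := by
    intro x y hxy
    rw [gromovProd, gromovProd, Fr, Fr]
    rcases hxy with hx | hy
    · rw [hπ0 x hx, F1, hx]; ring
    · rw [hπ0 y hy, dist_comm (π' x), F1, hy, dist_comm (π (ρ y))]; ring
  have hfτ : dist r (π τ) = m := by rw [hτ, hγd hm0 hmd]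
  have F2 : ∀ x y, 0 < e x → 0 < e y → dist (π' x) (π' y) = |e x - e y| := by
    intro x y hx hy
    rw [hπ1 x hx, hπ1 y hy, hγ.dist_map _ ⟨by linarith, by linarith [hel x]⟩ _
      ⟨by linarith, by linarith [hel y]⟩]
    congr 1; ring
  have G2 : ∀ x y, 0 < e x → 0 < e y → gromovProd r (π' x) (π' y) = m + min (e x) (e y) := by
    intro x y hx hy
    rw [gromovProd, Fr, Fr, F2 x y hx hy, heρ x hx, heρ y hy, hfτ]
    rcases le_total (e x) (e y) with hxy | hxy
    · rw [abs_of_nonpos (sub_nonpos.2 hxy), min_eq_left hxy]; ring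
    · rw [abs_of_nonneg (sub_nonneg.2 hxy), min_eq_right hxy]; ring
  have hlift : ∀ σ, ∃ t, ρ t = σ ∧ e t = 0 := by
    intro σ
    obtain ⟨t, h1, h2⟩ := exists_collapseTime_eq (τ := τ) hc0 σ
    exact ⟨t, h1, by simp [he, h2]⟩
  have hsub : Set.range π ⊆ Set.range π' := by
    rintro _ ⟨σ, rfl⟩
    obtain ⟨t, h1, h2⟩ := hlift σ
    exact ⟨t, by rw [hπ0 t h2, h1]⟩
  have hbranch : ∀ v, dist r v + dist v y₀ = dist r y₀ → v ∈ Set.range π' := by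
    intro v hv
    rcases le_or_gt (dist r v) m with hvm | hvm
    · exact hsub (hlow v hv hvm)
    have hvd : dist r v ≤ dist r y₀ := by linarith [dist_nonneg (x := v) (y := y₀)]
    have hvγ : γ (dist r v) = v := by
      have h1 := hyp (γ (dist r v)) y₀ v
      rw [hγg dist_nonneg hvd, gromovProd_comm r y₀ v] at h1
      have h2 : gromovProd r v y₀ = dist r v := by rw [gromovProd]; linarith
      rw [h2, min_self, gromovProd, hγd dist_nonneg hvd] at h1
      exact dist_le_zero.1 (by linarith)
    have he1 : e (τ + κ * (dist r v - m)) = dist r v - m := by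
      simp only [he]
      rw [tent_add (mul_nonneg hκ0.le (by linarith))
        (mul_le_mul_of_nonneg_left (by linarith) hκ0.le)]
      field_simp
    exact ⟨τ + κ * (dist r v - m), by rw [hπ1 _ (by rw [he1]; linarith), he1,
      add_sub_cancel, hvγ]⟩
  have hcB : c ≤ B ^ p := by
    calc c ≤ κ * B := mul_le_mul_of_nonneg_left hlB hκ0.le
      _ = B ^ p := by rw [hκ, Real.rpow_sub_one hB0.ne']; field_simp
  refine ⟨π', a + 2 * c, ⟨by linarith [h.nonneg], ?_, ?_, ?_, ?_, ?_⟩, by linarith, hsub,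
    hbranch y₀ (by simp)⟩
  · intro t ht
    obtain ⟨h1, h2⟩ := collapseTime_of_nonpos hτI.1 hc0 ht
    rw [hπ0 t (by simp [he, h2]), hρ, h1, h.eq_of_nonpos t ht]
  · intro t ht
    obtain ⟨h1, h2⟩ := collapseTime_of_ge hτI.2 hc0 ht
    rw [hπ0 t (by simp [he, h2]), h.eq_of_ge _ h1]
  · refine ⟨insert y₀ S, hSfin.insert y₀, Set.insert_nonempty _ _, ?_⟩
    refine Set.Subset.antisymm ?_ ?_
    · rintro _ ⟨t, rfl⟩
      rcases (he0 t).eq_or_lt with h0 | h0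
      · rw [hπ0 t h0.symm]
        have : π (ρ t) ∈ Set.range π := ⟨_, rfl⟩
        rw [hS] at this
        obtain ⟨s, hs, hd⟩ := this
        exact ⟨s, Set.mem_insert_of_mem _ hs, hd⟩
      · refine ⟨y₀, Set.mem_insert _ _, ?_⟩
        have := hel t
        rw [hπ1 t h0, hγd (by linarith) (by linarith), hγ.dist_right ⟨by linarith, by linarith⟩]
        ring
    · rintro v ⟨s, hs, hd⟩
      rcases Set.mem_insert_iff.1 hs with rfl | hs
      · exact hbranch v hd
      · refine hsub ?_
        rw [hS]
        exact ⟨s, hs, hd⟩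
  · intro x t y hxt hty
    by_cases hxy : e x = 0 ∨ e y = 0
    · rw [G1 x y hxy, Fr]
      have := h.contour _ _ _ (collapseTime_mono (τ := τ) (c := c) hxt)
        (collapseTime_mono (τ := τ) (c := c) hty)
      linarith [he0 t]
    · push Not at hxy
      have hx := (he0 x).lt_of_ne' hxy.1
      have hy := (he0 y).lt_of_ne' hxy.2
      have h1 : min (e x) (e y) ≤ e t := by
        have := min_tent_le (τ := τ) (c := c) hxt hty
        rw [heκ, heκ, heκ, ← mul_min_of_nonneg _ _ hκ0.le] at this
        exact le_of_mul_le_mul_left this hκ0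
      have ht : 0 < e t := (lt_min hx hy).trans_le h1
      rw [G2 x y hx hy, Fr, heρ t ht, hfτ]
      linarith
  · intro x y w hw
    have hold : ∀ z, dist (π z) w = dist (π z) (π' y) + dist (π' y) w := by
      intro z
      obtain ⟨t, ht⟩ := hsub ⟨z, rfl⟩
      rw [← ht, hw]
    have hyw : dist (π (ρ y)) w = e y + dist (π' y) w := by
      rw [hold, F1, dist_self, zero_add]
    have hold' : ∀ z, dist (π z) w = dist (π z) (π (ρ y)) + dist (π (ρ y)) w := by
      intro z
      rw [hold, F1, hyw]; ring
    have hwB := hproj w _ hold'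
    have ih := h.slow (ρ x) (ρ y) w hold'
    have hd0 : 0 ≤ dist (π' y) w := dist_nonneg
    have hp0 : 0 ≤ p := by linarith
    rcases (he0 y).eq_or_lt with hy | hy
    · rw [G1 x y (Or.inr hy.symm), hπ0 y hy.symm]
      refine ih.trans (mul_le_mul_of_nonneg_left (abs_collapseTime_sub_le hc0) hp0)
    have hρy := heρ y hy
    rcases (he0 x).eq_or_lt with hx | hx
    · have h1 := abs_collapseTime_sub_add_tent_le (τ := τ) hc0 (x := x) (y := y)
        (by rw [heκ, ← hx, mul_zero]) (by rw [heκ]; positivity)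
      have h2 := rpow_sub_rpow_le hp hd0 (a := dist (π (ρ y)) w) (by linarith) hwB
      have h3 : dist (π (ρ y)) w - dist (π' y) w = e y := by linarith
      rw [h3, ← hκ, mul_comm (e y), ← heκ] at h2
      rw [G1 x y (Or.inl hx.symm), Fr]
      have h4 : dist r (π (ρ y)) + e y - gromovProd r (π (ρ x)) (π (ρ y)) + dist (π' y) w
          = dist r (π (ρ y)) - gromovProd r (π (ρ x)) (π (ρ y)) + dist (π (ρ y)) w := by
        linarith
      rw [h4]
      have h5 := mul_le_mul_of_nonneg_left h1 hp0
      rw [hρy] at ih h2 ⊢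
      rw [mul_add] at h5
      linarith
    · rw [G2 x y hx hy, Fr, hρy, hfτ]
      have h1 : m + e y - (m + min (e x) (e y)) + dist (π' y) w
          ≤ B := by
        have := lt_min hx hy
        linarith
      have h2 := rpow_sub_rpow_le hp hd0 (by linarith [min_le_right (e x) (e y)]) h1
      refine h2.trans (mul_le_mul_of_nonneg_left ?_ hp0)
      have h3 := abs_tent_sub_le (τ := τ) (c := c) (x := x) (y := y)
      rw [heκ, heκ, ← mul_sub, abs_mul, abs_of_pos hκ0, mul_comm] at h3
      refine le_trans (mul_le_mul_of_nonneg_right ?_ hκ0.le) h3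
      rcases min_choice (e x) (e y) with h4 | h4 <;> rw [h4]
      · linarith [neg_le_abs (e x - e y)]
      · linarith [abs_nonneg (e x - e y)]

/-- Inserting finitely many points. -/
theorem exists_insert_finset (hyp : ∀ x y z : T,
      min (gromovProd r x y) (gromovProd r y z) ≤ gromovProd r x z)
    (hgeo : ∀ x y : T, ∃ γ, IsGeodesic γ x y) (hp : 1 ≤ p) (h : IsTreeContour r p π a)
    {B : ℝ} (hB0 : 0 < B) (hB : ∀ z, ∃ t, dist (π t) z ≤ B) (F : Finset T) :
    ∃ π' a', IsTreeContour r p π' a' ∧ a' ≤ a + F.card * (2 * B ^ p) ∧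
      Set.range π ⊆ Set.range π' ∧ ∀ z ∈ F, z ∈ Set.range π' := by
  classical
  induction F using Finset.induction_on with
  | empty => exact ⟨π, a, h, by simp, subset_rfl, by simp⟩
  | insert y F hy ih =>
    obtain ⟨π₁, a₁, h₁, ha₁, hs₁, hF₁⟩ := ih
    have hB₁ : ∀ z, ∃ t, dist (π₁ t) z ≤ B := by
      intro z
      obtain ⟨t, ht⟩ := hB z
      obtain ⟨s, hs⟩ := hs₁ ⟨t, rfl⟩
      exact ⟨s, by rwa [hs]⟩
    obtain ⟨π₂, a₂, h₂, ha₂, hs₂, hy₂⟩ := h₁.exists_insert hyp hgeo hp hB0 hB₁ y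
    refine ⟨π₂, a₂, h₂, ?_, hs₁.trans hs₂, ?_⟩
    · rw [Finset.card_insert_of_notMem hy]
      push_cast
      linarith
    · intro z hz
      rcases Finset.mem_insert.1 hz with rfl | hz
      · exact hy₂
      · exact hs₂ (hF₁ z hz)

end IsTreeContour

/-- A curve in a zero-hyperbolic space passes below the branch point of its endpoints. -/
theorem exists_dist_le_gromovProd {T : Type*} [MetricSpace T] {r : T}
    (hyp : ∀ x y z : T, min (gromovProd r x y) (gromovProd r y z) ≤ gromovProd r x z)
    {π : ℝ → T} (hπ : Continuous π) {x y : ℝ} (hxy : x ≤ y) :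
    ∃ t ∈ Set.Icc x y, dist r (π t) ≤ gromovProd r (π x) (π y) := by
  by_contra! hcon
  obtain ⟨t₀, ht₀, hmin⟩ := isCompact_Icc.exists_isMinOn (Set.nonempty_Icc.2 hxy)
    (f := fun t => dist r (π t)) (by fun_prop)
  set g := gromovProd r (π x) (π y)
  set μ := dist r (π t₀)
  have hgμ : g < μ := hcon t₀ ht₀
  have hμ : ∀ t ∈ Set.Icc x y, μ ≤ dist r (π t) := fun t ht => hmin ht
  set u : Set ℝ := {t | (g + μ) / 2 < gromovProd r (π x) (π t)} with hu
  have huo : IsOpen u := isOpen_lt continuous_const (by simp only [gromovProd]; fun_prop)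
  have hsub : Set.Icc x y ⊆ u := by
    refine isPreconnected_Icc.subset_of_closure_inter_subset huo
      ⟨x, ⟨le_rfl, hxy⟩, ?_⟩ ?_
    · have := hμ x ⟨le_rfl, hxy⟩
      simp only [hu, Set.mem_ofPred_eq, gromovProd_self]
      linarith
    · rintro t ⟨ht, htI⟩
      obtain ⟨t', ht'1, ht'2⟩ := mem_closure_iff.1 ht {t' | dist (π t') (π t) < (μ - g) / 2}
        (isOpen_lt (by fun_prop) continuous_const) (by simp [hgμ])
      refine lt_of_lt_of_le (lt_min ht'2 ?_) (hyp (π x) (π t') (π t))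
      have h1 := hμ t htI
      have h2 := dist_triangle r (π t') (π t)
      rw [Set.mem_ofPred_eq] at ht'1
      rw [gromovProd]
      linarith
  have := hsub ⟨hxy, le_rfl⟩
  simp only [hu, Set.mem_ofPred_eq] at this
  change (g + μ) / 2 < g at this
  linarith

theorem exists_finset_card_eq_coverNumber (Z : Type*) [PseudoMetricSpace Z] [CompactSpace Z]
    {ε : ℝ} (hε : 0 < ε) :
    ∃ s : Finset Z, s.card = coverNumber Z ε ∧ ∀ z, ∃ x ∈ s, dist x z ≤ ε := by
  have hne : {n : ℕ | ∃ s : Finset Z, s.card = n ∧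
      (Set.univ : Set Z) ⊆ ⋃ x ∈ s, Metric.closedBall x ε}.Nonempty := by
    obtain ⟨t, -, ht, hcov⟩ := finite_cover_balls_of_compact (isCompact_univ (X := Z)) hε
    refine ⟨_, ht.toFinset, rfl, hcov.trans ?_⟩
    simp only [Set.Finite.mem_toFinset]
    exact Set.iUnion₂_mono fun x _ => Metric.ball_subset_closedBall
  obtain ⟨s, hs, hcov⟩ := Nat.sInf_mem hne
  refine ⟨s, hs, fun z => ?_⟩
  obtain ⟨x, hx, hz⟩ := Set.mem_iUnion₂.1 (hcov (Set.mem_univ z))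
  exact ⟨x, hx, by rwa [dist_comm]⟩

theorem eventually_coverNumber_le {Z : Type*} [PseudoMetricSpace Z] {q : ℝ}
    (h : updim Z < (q : EReal)) :
    ∀ᶠ ε in nhdsWithin (0 : ℝ) (Set.Ioi 0), (coverNumber Z ε : ℝ) ≤ (1 / ε) ^ q := by
  filter_upwards [Filter.eventually_lt_of_limsup_lt h,
    Ioo_mem_nhdsGT (zero_lt_one' ℝ)] with ε hε hε1
  rw [EReal.coe_lt_coe_iff] at hε
  have h1 : 1 < 1 / ε := by rw [lt_div_iff₀ hε1.1]; linarith [hε1.2]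
  rw [div_lt_iff₀ (Real.log_pos h1)] at hε
  rcases (Nat.cast_nonneg (α := ℝ) (coverNumber Z ε)).eq_or_lt with h0 | h0
  · rw [← h0]; positivity
  · exact (Real.le_rpow_iff_log_le h0 (by linarith)).2 hε.le

theorem dist_le_mul_coverNumber {Z : Type*} [MetricSpace Z] [CompactSpace Z] [ConnectedSpace Z]
    {ε : ℝ} (hε : 0 < ε) (x y : Z) : dist x y ≤ coverNumber Z ε * (2 * ε) := by
  obtain ⟨s, hs, hcov⟩ := exists_finset_card_eq_coverNumber Z hε
  have hsub : Set.Icc 0 (dist x y) ⊆ ⋃ z ∈ s, Set.Icc (dist x z - ε) (dist x z + ε) := by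
    intro t ht
    obtain ⟨w, rfl⟩ := intermediate_value_univ x y
      (f := fun w => dist x w) (by fun_prop) (by simpa using ht)
    obtain ⟨z, hz, hd⟩ := hcov w
    refine Set.mem_iUnion₂.2 ⟨z, hz, ?_⟩
    have h1 := dist_triangle x z w
    have h2 := dist_triangle_right x z w
    exact ⟨by linarith, by linarith⟩
  have h1 := (MeasureTheory.measure_mono (μ := MeasureTheory.volume) hsub).trans
    (MeasureTheory.measure_biUnion_finset_le s _)
  have h2 : ∀ z, dist x z + ε - (dist x z - ε) = 2 * ε := fun z => by ring
  simp only [Real.volume_Icc, sub_zero, h2, Finset.sum_const, nsmul_eq_mul] at h1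
  rw [← ENNReal.ofReal_natCast, ← ENNReal.ofReal_mul (by positivity),
    ENNReal.ofReal_le_ofReal_iff (by positivity), hs] at h1
  exact h1

/-- The box dimension of a nontrivial continuum is at least one. -/
theorem one_le_of_updim_lt {Z : Type*} [MetricSpace Z] [CompactSpace Z] [ConnectedSpace Z]
    [Nontrivial Z] {q : ℝ} (h : updim Z < (q : EReal)) : 1 ≤ q := by
  by_contra! hq
  obtain ⟨x, y, hxy⟩ := exists_pair_ne Z
  have hlim : Filter.Tendsto (fun ε : ℝ => 2 * ε ^ (1 - q)) (nhdsWithin 0 (Set.Ioi 0))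
      (nhds (2 * (0 : ℝ) ^ (1 - q))) :=
    ((Real.continuousAt_rpow_const 0 (1 - q) (Or.inr (by linarith))).tendsto.const_mul 2).mono_left
      nhdsWithin_le_nhds
  rw [Real.zero_rpow (by linarith), mul_zero] at hlim
  obtain ⟨ε, h1, h2, h3⟩ := ((hlim.eventually_lt_const (dist_pos.2 hxy)).and
    ((eventually_coverNumber_le h).and self_mem_nhdsWithin)).exists
  have hε : 0 < ε := h3
  have h4 := dist_le_mul_coverNumber hε x y
  have h5 : (1 / ε) ^ q * (2 * ε) = 2 * ε ^ (1 - q) := by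
    rw [Real.rpow_sub hε, Real.rpow_one, Real.div_rpow zero_le_one hε.le, Real.one_rpow]
    ring
  have h6 := mul_le_mul_of_nonneg_right h2 (by positivity : 0 ≤ 2 * ε)
  linarith

namespace IsTreeContour

variable {T : Type*} [MetricSpace T] {r : T} {p : ℝ} {π : ℝ → T} {a : ℝ}

theorem dist_le (h : IsTreeContour r p π a) (hp : 0 < p) (x y : ℝ) :
    dist (π x) (π y) ≤ 2 * (p * |x - y|) ^ p⁻¹ := by
  have key : ∀ x y, dist r (π y) - gromovProd r (π x) (π y) ≤ (p * |x - y|) ^ p⁻¹ := by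
    intro x y
    have h1 := h.slow x y (π y) (by simp)
    rw [dist_self, add_zero, Real.zero_rpow hp.ne', sub_zero] at h1
    exact (Real.le_rpow_inv_iff_of_pos (sub_nonneg.2 (gromovProd_le_right _ _ _))
      (by positivity) hp).2 h1
  have h1 := key x y
  have h2 := key y x
  rw [abs_sub_comm, gromovProd_comm] at h2
  have h3 : dist (π x) (π y) = (dist r (π y) - gromovProd r (π x) (π y)) +
      (dist r (π x) - gromovProd r (π x) (π y)) := by
    rw [gromovProd]; ring
  linarith

/-- Tree contours of bounded duration filling the space up to arbitrarily small errors. -/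
theorem exists_dense [CompactSpace T] (hyp : ∀ x y z : T,
      min (gromovProd r x y) (gromovProd r y z) ≤ gromovProd r x z)
    (hgeo : ∀ x y : T, ∃ γ, IsGeodesic γ x y) {q : ℝ} (hp : 1 ≤ p) (hq : q < p)
    (hdim : updim T < (q : EReal)) :
    ∃ (A : ℝ) (b : ℕ → ℝ), Filter.Tendsto b Filter.atTop (nhds 0) ∧
      ∀ k, ∃ π a, IsTreeContour r p π a ∧ a ≤ A ∧ ∀ z, ∃ t, dist (π t) z ≤ b k := by
  have hp0 : 0 < p := by linarith
  obtain ⟨ε, hε : 0 < ε, hcov⟩ := mem_nhdsGT_iff_exists_Ioc_subset.1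
    (eventually_coverNumber_le hdim)
  set b : ℕ → ℝ := fun k => ε * (1 / 2) ^ k with hb
  have hb0 : ∀ k, 0 < b k := fun k => by positivity
  have hbε : ∀ k, b k ≤ ε := fun k =>
    mul_le_of_le_one_right hε.le (pow_le_one₀ (by norm_num) (by norm_num))
  have hblim : Filter.Tendsto b Filter.atTop (nhds 0) := by
    have := (tendsto_pow_atTop_nhds_zero_of_lt_one (r := (1 / 2 : ℝ)) (by norm_num)
      (by norm_num)).const_mul ε
    rwa [mul_zero] at this
  obtain ⟨π₀, a₀, h₀, hd₀⟩ : ∃ π a, IsTreeContour r p π a ∧ ∀ z, ∃ t, dist (π t) z ≤ b 0 := by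
    obtain ⟨F, -, hF⟩ := exists_finset_card_eq_coverNumber T (hb0 0)
    have hB : ∀ z : T, dist r z ≤ Metric.diam (Set.univ : Set T) + 1 := fun z =>
      (Metric.dist_le_diam_of_mem isCompact_univ.isBounded (Set.mem_univ _)
        (Set.mem_univ _)).trans (by linarith)
    obtain ⟨π, a, h, -, -, hFr⟩ := (const r hp0).exists_insert_finset hyp hgeo hp
      (B := Metric.diam (Set.univ : Set T) + 1)
      (add_pos_of_nonneg_of_pos Metric.diam_nonneg one_pos)
      (fun z => ⟨0, hB z⟩) F
    refine ⟨π, a, h, fun z => ?_⟩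
    obtain ⟨x, hx, hxz⟩ := hF z
    obtain ⟨t, rfl⟩ := hFr x hx
    exact ⟨t, hxz⟩
  set θ : ℝ := (1 / 2) ^ (p - q) with hθ
  have hθ0 : 0 ≤ θ := by positivity
  have hθ1 : θ < 1 := Real.rpow_lt_one (by norm_num) (by norm_num) (by linarith)
  set C : ℝ := 2 * 2 ^ p * ε ^ (p - q) with hC
  have hC0 : 0 ≤ C := by positivity
  have hcost : ∀ k, (coverNumber T (b (k + 1)) : ℝ) * (2 * b k ^ p) ≤ C * θ ^ k := by
    intro k
    have h1 : (coverNumber T (b (k + 1)) : ℝ) ≤ (1 / b (k + 1)) ^ q :=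
      hcov ⟨hb0 _, hbε _⟩
    have h2 : b k = 2 * b (k + 1) := by simp only [hb, pow_succ]; ring
    have hb1 := hb0 (k + 1)
    have h3 : b (k + 1) ^ (p - q) ≤ b k ^ (p - q) :=
      Real.rpow_le_rpow hb1.le (by linarith) (by linarith)
    have h4 : b k ^ (p - q) = ε ^ (p - q) * θ ^ k := by
      simp only [hb, hθ]
      rw [Real.mul_rpow hε.le (by positivity), ← Real.rpow_natCast, ← Real.rpow_natCast,
        ← Real.rpow_mul (by norm_num), ← Real.rpow_mul (by norm_num), mul_comm (k : ℝ)]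
    calc (coverNumber T (b (k + 1)) : ℝ) * (2 * b k ^ p)
        ≤ (1 / b (k + 1)) ^ q * (2 * b k ^ p) := by gcongr
      _ = 2 * 2 ^ p * b (k + 1) ^ (p - q) := by
        rw [h2, Real.mul_rpow two_pos.le hb1.le, Real.rpow_sub hb1,
          Real.div_rpow zero_le_one hb1.le, Real.one_rpow]
        ring
      _ ≤ 2 * 2 ^ p * b k ^ (p - q) := by gcongr
      _ = C * θ ^ k := by rw [h4, hC]; ring
  refine ⟨a₀ + C * ∑' j, θ ^ j, b, hblim, fun k => ?_⟩
  have hk : ∃ π a, IsTreeContour r p π a ∧ a ≤ a₀ + C * ∑ j ∈ Finset.range k, θ ^ j ∧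
      ∀ z, ∃ t, dist (π t) z ≤ b k := by
    induction k with
    | zero => exact ⟨π₀, a₀, h₀, by simp, hd₀⟩
    | succ k ih =>
      obtain ⟨π, a, h, ha, hd⟩ := ih
      obtain ⟨F, hFc, hF⟩ := exists_finset_card_eq_coverNumber T (hb0 (k + 1))
      obtain ⟨π', a', h', ha', -, hFr⟩ := h.exists_insert_finset hyp hgeo hp (hb0 k) hd F
      refine ⟨π', a', h', ?_, fun z => ?_⟩
      · rw [hFc] at ha'
        rw [Finset.sum_range_succ]
        linarith [hcost k]
      · obtain ⟨x, hx, hxz⟩ := hF z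
        obtain ⟨t, rfl⟩ := hFr x hx
        exact ⟨t, hxz⟩
  obtain ⟨π, a, h, ha, hd⟩ := hk
  have hsum := (summable_geometric_of_lt_one hθ0 hθ1).sum_le_tsum (Finset.range k)
    (fun j _ => by positivity)
  exact ⟨π, a, h, ha.trans (by gcongr), hd⟩

end IsTreeContour

/-- A compact zero-hyperbolic geodesic space of box dimension less than `p` is filled by a
`p⁻¹`-Hölder curve which is the contour of a tree. -/
theorem exists_holder_contour {T : Type*} [MetricSpace T] [CompactSpace T] {r : T} {p q : ℝ}
    (hyp : ∀ x y z : T, min (gromovProd r x y) (gromovProd r y z) ≤ gromovProd r x z)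
    (hgeo : ∀ x y : T, ∃ γ, IsGeodesic γ x y) (hp : 1 ≤ p) (hq : q < p)
    (hdim : updim T < (q : EReal)) :
    ∃ (π : ℝ → T) (A : ℝ), (∀ x y, dist (π x) (π y) ≤ 2 * (p * |x - y|) ^ p⁻¹) ∧
      (∀ x t y, x ≤ t → t ≤ y → gromovProd r (π x) (π y) ≤ dist r (π t)) ∧
      ∀ z, ∃ t ∈ Set.Icc 0 A, π t = z := by
  have hp0 : 0 < p := by linarith
  obtain ⟨A, b, hb, h⟩ := IsTreeContour.exists_dense (r := r) hyp hgeo hp hq hdim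
  choose P a hP ha hd using h
  let U : Ultrafilter ℕ := Filter.hyperfilter ℕ
  have : Nonempty T := ⟨r⟩
  obtain ⟨π, hπ⟩ : ∃ π : ℝ → T, Filter.Tendsto P U (nhds π) := ⟨_, (U.map P).le_nhds_lim⟩
  rw [tendsto_pi_nhds] at hπ
  refine ⟨π, A, fun x y => ?_, fun x t y hxt hty => ?_, fun z => ?_⟩
  · exact le_of_tendsto ((hπ x).dist (hπ y)) (Filter.Eventually.of_forall fun k =>
      (hP k).dist_le hp0 x y)
  · refine le_of_tendsto_of_tendsto (b := (U : Filter ℕ)) ?_ (tendsto_const_nhds.dist (hπ t))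
      (Filter.Eventually.of_forall fun k => (hP k).contour x t y hxt hty)
    exact (((tendsto_const_nhds.dist (hπ x)).add (tendsto_const_nhds.dist (hπ y))).sub
      ((hπ x).dist (hπ y))).div_const 2
  · have hz : ∀ k, ∃ t ∈ Set.Icc 0 A, dist (P k t) z ≤ b k := by
      intro k
      obtain ⟨t, ht⟩ := hd k z
      obtain ⟨s, hs, hst⟩ := (hP k).exists_mem_Icc t
      exact ⟨s, ⟨hs.1, hs.2.trans (ha k)⟩, by rwa [hst]⟩
    choose t htI ht using hz
    obtain ⟨s, hs, hts⟩ := isCompact_Icc.ultrafilter_le_nhds' (U.map t)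
      (Filter.mem_map.2 (Filter.Eventually.of_forall htI))
    refine ⟨s, hs, dist_le_zero.1 ?_⟩
    have hts' : Filter.Tendsto t U (nhds s) := hts
    have hlim : Filter.Tendsto (fun k => dist (π s) (P k s) + 2 * (p * |s - t k|) ^ p⁻¹ + b k) U
        (nhds (dist (π s) (π s) + 2 * (p * |s - s|) ^ p⁻¹ + 0)) := by
      refine ((tendsto_const_nhds.dist (hπ s)).add (Filter.Tendsto.const_mul 2 ?_)).add
        (hb.mono_left Nat.hyperfilter_le_atTop)
      exact (((tendsto_const_nhds.sub hts').abs).const_mul p).rpow_const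
        (Or.inr (by positivity))
    rw [dist_self, sub_self, abs_zero, mul_zero, Real.zero_rpow (by positivity)] at hlim
    simp only [mul_zero, add_zero] at hlim
    refine ge_of_tendsto hlim (Filter.Eventually.of_forall fun k => ?_)
    have h1 := dist_triangle4 (π s) (P k s) (P k (t k)) z
    have h2 := (hP k).dist_le hp0 s (t k)
    linarith [ht k]

/-- On the unit interval, the optimal path between two points is the segment. -/
theorem pathInfSup_eq {f : unitInterval → ℝ} (hf : BddBelow (Set.range f)) {x y : unitInterval}
    {m : ℝ} (hle : ∀ t ∈ Set.uIcc x y, m ≤ f t) (hex : ∃ t ∈ Set.uIcc x y, f t ≤ m) :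
    pathInfSup f x y = m := by
  obtain ⟨t₀, ht₀, hft₀⟩ := hex
  have hub : ∀ s ∈ {s : ℝ | ∃ γ : Path x y, s = ⨅ t : unitInterval, f (γ t)}, s ≤ m := by
    rintro _ ⟨γ, rfl⟩
    have hrange : Set.uIcc x y ⊆ Set.range γ := by
      have := isPreconnected_univ.image γ γ.continuous.continuousOn
      rw [Set.image_univ] at this
      exact this.ordConnected.uIcc_subset ⟨0, γ.source⟩ ⟨1, γ.target⟩
    obtain ⟨u, rfl⟩ := hrange ht₀
    exact (ciInf_le (hf.mono (Set.range_comp_subset_range γ f)) u).trans hft₀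
  have hpath : ∃ γ : Path x y, ∀ t, γ t ∈ Set.uIcc x y := by
    let g : unitInterval → unitInterval := fun t =>
      ⟨(x : ℝ) + t * ((y : ℝ) - x), by
        have := (convex_Icc (0 : ℝ) 1).add_smul_sub_mem x.2 y.2 t.2
        simpa using this⟩
    refine ⟨⟨⟨g, by fun_prop⟩, by simp [g], by simp [g]⟩, fun t => ?_⟩
    have h1 := t.2.1
    have h2 := t.2.2
    change g t ∈ _
    rcases le_total x y with hxy | hxy
    · have hxy' : (x : ℝ) ≤ y := hxy
      rw [Set.uIcc_of_le hxy]
      refine ⟨Subtype.coe_le_coe.1 ?_, Subtype.coe_le_coe.1 ?_⟩ <;> simp only [g] <;> nlinarith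
    · have hxy' : (y : ℝ) ≤ x := hxy
      rw [Set.uIcc_of_ge hxy]
      refine ⟨Subtype.coe_le_coe.1 ?_, Subtype.coe_le_coe.1 ?_⟩ <;> simp only [g] <;> nlinarith
  obtain ⟨γ, hγ⟩ := hpath
  refine le_antisymm (csSup_le ⟨_, γ, rfl⟩ hub) ?_
  exact (le_ciInf fun t => hle _ (hγ t)).trans (le_csSup ⟨m, hub⟩ ⟨γ, rfl⟩)

/-- let `T` be a nonempty compact connected geodesic metric space with no
subspace homeomorphic to the circle (a compact ℝ-tree) whose upper box dimension is a
finite value `D`. Then for every `δ > 0` there is a continuous,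
`(1/(D+δ))`-Hölder function `f : [0,1] → ℝ` whose tree `T_f` is isometric to `T`;
this is encoded by a surjection `π : [0,1] → T` with `dist (π x) (π y) = d_f(x,y)`. -/
theorem tree_realized_by_function (T : Type*) [MetricSpace T] [Nonempty T]
    [CompactSpace T] [ConnectedSpace T]
    (hgeo : ∀ x y : T, ∃ γ : ℝ → T, γ 0 = x ∧ γ (dist x y) = y ∧
      ∀ s ∈ Set.Icc (0 : ℝ) (dist x y), ∀ t ∈ Set.Icc (0 : ℝ) (dist x y),
        dist (γ s) (γ t) = |s - t|)
    (hnocircle : ¬ ∃ φ : Circle → T, Topology.IsEmbedding φ)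
    (D : ℝ) (hD : updim T = (D : EReal)) :
    ∀ δ > (0 : ℝ), ∃ f : unitInterval → ℝ, Continuous f ∧
      (∃ K : ℝ, ∀ x y : unitInterval, |f x - f y| ≤ K * dist x y ^ (1 / (D + δ))) ∧
      ∃ π : unitInterval → T, Function.Surjective π ∧
        ∀ x y : unitInterval, dist (π x) (π y) = dPseudo f x y := by
  intro δ hδ
  obtain ⟨r⟩ := ‹Nonempty T›
  rcases subsingleton_or_nontrivial T with hT | hT
  · refine ⟨fun _ => 0, continuous_const, ⟨1, fun x y => ?_⟩, fun _ => r,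
      fun z => ⟨0, Subsingleton.elim _ _⟩, fun x y => ?_⟩
    · simp only [sub_self, abs_zero]
      positivity
    · rw [dPseudo, pathInfSup_eq (m := 0) ⟨0, by rintro _ ⟨_, rfl⟩; rfl⟩ (fun _ _ => le_rfl)
        ⟨x, Set.left_mem_uIcc, le_rfl⟩]
      simp
  have hgeo' := exists_isGeodesic hgeo
  have hyp := min_gromovProd_le hgeo' hnocircle r
  have hdim : updim T < ((D + δ / 2 : ℝ) : EReal) := by
    rw [hD, EReal.coe_lt_coe_iff]
    linarith
  have hq := one_le_of_updim_lt hdim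
  set p := D + δ with hp
  have hp1 : 1 ≤ p := by linarith
  have hp0 : 0 < p := by linarith
  obtain ⟨π, A', hhol, hcontour, hsurj⟩ :=
    exists_holder_contour (r := r) hyp hgeo' hp1 (by linarith) hdim
  set A := max A' 1 with hA
  have hA0 : 0 < A := lt_max_of_lt_right one_pos
  have hπ : Continuous π := by
    refine continuous_iff_continuousAt.2 fun x => tendsto_iff_dist_tendsto_zero.2 ?_
    have hlim : Filter.Tendsto (fun y => 2 * (p * |y - x|) ^ p⁻¹) (nhds x)
        (nhds (2 * (p * |x - x|) ^ p⁻¹)) :=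
      (((by fun_prop : Continuous fun y => p * |y - x|).rpow_const
        fun _ => Or.inr (by positivity)).const_mul 2).tendsto x
    rw [sub_self, abs_zero, mul_zero, Real.zero_rpow (by positivity), mul_zero] at hlim
    exact squeeze_zero (fun _ => dist_nonneg) (fun y => hhol y x) hlim
  refine ⟨fun u => dist r (π (A * u)), by fun_prop, ⟨2 * (p * A) ^ p⁻¹, fun x y => ?_⟩,
    fun u => π (A * u), fun z => ?_, ?_⟩
  · have h1 := abs_dist_sub_le (π (A * x)) (π (A * y)) r
    rw [dist_comm _ r, dist_comm _ r] at h1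
    refine h1.trans ((hhol _ _).trans_eq ?_)
    rw [← mul_sub, abs_mul, abs_of_pos hA0, ← mul_assoc, Real.mul_rpow (by positivity)
      (abs_nonneg _), one_div, Subtype.dist_eq, Real.dist_eq, mul_assoc]
  · obtain ⟨t, ht, rfl⟩ := hsurj z
    refine ⟨⟨t / A, div_nonneg ht.1 hA0.le, ?_⟩, ?_⟩
    · exact (div_le_one hA0).2 (ht.2.trans (le_max_left _ _))
    · simp only
      rw [mul_div_cancel₀ _ hA0.ne']
  · have key : ∀ x y : unitInterval, x ≤ y →
        pathInfSup (fun u : unitInterval => dist r (π (A * u))) x y =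
          gromovProd r (π (A * x)) (π (A * y)) ∧
        pathInfSup (fun u : unitInterval => dist r (π (A * u))) y x =
          gromovProd r (π (A * x)) (π (A * y)) := by
      intro x y hxy
      have hbdd : BddBelow (Set.range fun u : unitInterval => dist r (π (A * u))) :=
        ⟨0, by rintro _ ⟨u, rfl⟩; exact dist_nonneg⟩
      have hle : ∀ t ∈ Set.uIcc x y,
          gromovProd r (π (A * x)) (π (A * y)) ≤ dist r (π (A * t)) := by
        intro t ht
        rw [Set.uIcc_of_le hxy] at ht
        exact hcontour _ _ _ (mul_le_mul_of_nonneg_left (Subtype.coe_le_coe.2 ht.1) hA0.le)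
          (mul_le_mul_of_nonneg_left (Subtype.coe_le_coe.2 ht.2) hA0.le)
      have hex : ∃ t ∈ Set.uIcc x y,
          dist r (π (A * t)) ≤ gromovProd r (π (A * x)) (π (A * y)) := by
        obtain ⟨t, ht, hd⟩ := exists_dist_le_gromovProd hyp
          (π := fun s => π (A * s)) (by fun_prop) (Subtype.coe_le_coe.2 hxy)
        rw [Set.uIcc_of_le hxy]
        exact ⟨⟨t, x.2.1.trans ht.1, ht.2.trans y.2.2⟩, ht, hd⟩
      exact ⟨pathInfSup_eq hbdd hle hex,
        pathInfSup_eq hbdd (Set.uIcc_comm x y ▸ hle) (Set.uIcc_comm x y ▸ hex)⟩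
    intro x y
    rcases le_total x y with hxy | hxy
    · rw [dPseudo, (key x y hxy).1, gromovProd]; ring
    · rw [dPseudo, (key y x hxy).2, gromovProd, dist_comm (π (A * y))]; ring
end
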